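/- Let M be a nonempty connected compact topological n-dimensional manifold with nonempty boundary, where n = dim(M), let Int(M) = M − ∂M, and let Q_m be a finite set of m distinct points contained in Int(M). Then for every integer k ≥ 1 the inclusion map i_k(M − Q_m) : F(M − Q_m, k) → (M − Q_m)^k is (n−1)-connected: the induced homomorphism π_q(F(M − Q_m,k)) → π_q((M − Q_m)^k) is surjective for q = n−1 and is an isomorphism (respectively, a bijection of pointed sets for q = 0) for all 0 ≤ q ≤ n−2, for any choice of basepoint. -/

import Mathlib

open scoped Topology

/-- Ordered configuration space of `k` points in `X`: tuples of pairwise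
distinct points, i.e. injective functions `Fin k → X`, topologized as a
subspace of the product `X^k`. -/
abbrev Conf (X : Type*) [TopologicalSpace X] (k : ℕ) : Type _ :=
  {f : Fin k → X // Function.Injective f}

/-- Interior of a topological manifold with boundary: the set of points having
an open neighborhood homeomorphic to `ℝ^n`. -/
def mfdInterior (n : ℕ) (M : Type*) [TopologicalSpace M] : Set M :=
  {x | ∃ U : Set M, IsOpen U ∧ x ∈ U ∧ Nonempty (U ≃ₜ EuclideanSpace ℝ (Fin n))}

/-- The inclusion `i_k(X) : F(X,k) → X^k` of the configuration space into the
product. -/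
def confToPi (X : Type*) [TopologicalSpace X] (k : ℕ) : C(Conf X k, Fin k → X) :=
  ⟨fun f => f.1, continuous_subtype_val⟩

/-- The map of generalized loops induced by postcomposition with a continuous
map. -/
def GenLoop.induced {N : Type*} {X Y : Type*} [TopologicalSpace X] [TopologicalSpace Y]
    (f : C(X, Y)) {x : X} (p : GenLoop N X x) : GenLoop N Y (f x) :=
  ⟨f.comp p.1, fun y hy => by
    simp only [ContinuousMap.comp_apply]
    exact congrArg f (p.2 y hy)⟩

/-- The map `f_* : π_q(X, x) → π_q(Y, f x)` of homotopy groups induced by a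
continuous map `f`. -/
def HomotopyGroup.induced {N : Type*} {X Y : Type*} [TopologicalSpace X] [TopologicalSpace Y]
    (f : C(X, Y)) (x : X) :
    HomotopyGroup N X x → HomotopyGroup N Y (f x) :=
  Quotient.map (GenLoop.induced f)
    (fun _ _ h => h.map fun F => F.compContinuousMap f)

section GeneralPosition

open Set Filter ContinuousMap unitInterval

/-- A continuous map to `ℝⁿ` defined on a space embedded in a vector space of smaller dimension
can be missed, over a compact set, by arbitrarily small maps with nonnegative first coordinate. -/
theorem exists_small_forall_ne {n : ℕ} [NeZero n] {K V : Type*} [TopologicalSpace K]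
    [NormedAddCommGroup V] [NormedSpace ℝ V] [FiniteDimensional ℝ V]
    (hV : Module.finrank ℝ V < n) {ι : K → V} (hι : Topology.IsEmbedding ι)
    {C : Set K} (hC : IsCompact C) {h : K → EuclideanSpace ℝ (Fin n)} (hh : ContinuousOn h C)
    {ε : ℝ} (hε : 0 < ε) :
    ∃ ψ : C(K, EuclideanSpace ℝ (Fin n)),
      (∀ p, 0 ≤ ψ p 0 ∧ ‖ψ p‖ < ε) ∧ ∀ p ∈ C, ψ p ≠ h p := by
  have : CompactSpace C := isCompact_iff_compactSpace.1 hC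
  have hιC : Topology.IsClosedEmbedding (fun p : C => ι p) :=
    (hι.continuous.comp continuous_subtype_val).isClosedEmbedding
      (hι.injective.comp Subtype.val_injective)
  have := RCLike.instTietzeExtensionTVS (𝕜 := ℝ) (E := EuclideanSpace ℝ (Fin n))
  obtain ⟨H, hH⟩ := ContinuousMap.exists_extension' hιC ⟨C.domRestrict h, hh.domRestrict⟩
  obtain ⟨L, hL, hLH, -⟩ := H.continuous.exists_contDiff_approx 1
    (continuous_const (y := ε / 4)) (fun _ => by positivity)
  have hdense : Dense (range L)ᶜ := by
    refine ContDiff.dense_compl_range_of_finrank_lt_finrank (by exact_mod_cast hL) ?_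
    simpa using hV
  obtain ⟨w, hwL, hw⟩ := hdense.exists_dist_lt (EuclideanSpace.single 0 (ε / 2))
    (show 0 < ε / 4 by positivity)
  refine ⟨⟨fun p => H (ι p) - L (ι p) + w, ?_⟩, fun p => ⟨?_, ?_⟩, fun p hp heq => hwL ?_⟩
  · have := hι.continuous
    have := hL.continuous
    fun_prop
  · have h2 : |(H (ι p) - L (ι p)) 0| < ε / 4 :=
      (PiLp.norm_apply_le (H (ι p) - L (ι p)) 0).trans_lt
        (by rw [← dist_eq_norm, dist_comm]; exact hLH _)
    have h3 : |(EuclideanSpace.single 0 (ε / 2) - w : EuclideanSpace ℝ (Fin n)) 0| < ε / 4 :=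
      (PiLp.norm_apply_le (EuclideanSpace.single 0 (ε / 2) - w) 0).trans_lt
        (by rw [← dist_eq_norm]; exact hw)
    simp [abs_lt] at h2 h3 ⊢
    linarith
  · have h1 : ‖H (ι p) - L (ι p)‖ < ε / 4 := by rw [← dist_eq_norm, dist_comm]; exact hLH _
    have h2 : ‖w‖ < ε / 2 + ε / 4 := by
      have h3 := norm_le_insert' w (EuclideanSpace.single 0 (ε / 2))
      rw [← dist_eq_norm, dist_comm, PiLp.norm_single, Real.norm_of_nonneg (by positivity)]
        at h3
      linarith
    have := norm_add_le (H (ι p) - L (ι p)) w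
    simp only [coe_mk]
    linarith
  · have h1 : H (ι p) = h p := congr_fun hH ⟨p, hp⟩
    simp only [coe_mk, h1] at heq
    refine ⟨ι p, ?_⟩
    rw [sub_add_eq_add_sub, sub_eq_iff_eq_add] at heq
    exact (add_left_cancel heq).symm

/-- The vectors of norm less than `ε` with nonnegative first coordinate. -/
abbrev HalfBall (n : ℕ) [NeZero n] (ε : ℝ) : Type :=
  {v : EuclideanSpace ℝ (Fin n) // 0 ≤ v 0 ∧ ‖v‖ < ε}

/-- The contraction of a half-ball to its center. -/
def HalfBall.scale {n : ℕ} [NeZero n] {ε : ℝ} (t : I) (v : HalfBall n ε) : HalfBall n ε :=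
  ⟨(t : ℝ) • v.1, by simpa using mul_nonneg t.2.1 v.2.1, by
    rw [norm_smul, Real.norm_of_nonneg t.2.1]
    exact (mul_le_of_le_one_left (norm_nonneg _) t.2.2).trans_lt v.2.2⟩

/-- The family of perturbations of `g` within the chart `e` over `S`, cut off by `u`. -/
theorem exists_chart_perturbation {n : ℕ} [NeZero n] {K X : Type*} [TopologicalSpace K]
    [TopologicalSpace X] (e : OpenPartialHomeomorph X (EuclideanHalfSpace n)) (g : C(K, X))
    {S : Set K} (hS : IsCompact S) (hSc : IsClosed S) (hg : MapsTo g S e.source)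
    (u : C(K, ℝ)) (hu : ∀ p, u p ∈ Icc (0 : ℝ) 1) (hu0 : ∀ p ∉ interior S, u p = 0) :
    ∃ ε > 0, ∃ Ξ : C(K × HalfBall n ε, X),
      (∀ p v, v.1 = 0 → Ξ (p, v) = g p) ∧ (∀ p ∉ S, ∀ v, Ξ (p, v) = g p) ∧
      ∀ p ∈ S, ∀ v, (e (Ξ (p, v))).1 = (e (g p)).1 + u p • v.1 := by
  classical
  have hval : Continuous (Subtype.val : EuclideanHalfSpace n → EuclideanSpace ℝ (Fin n)) :=
    continuous_subtype_val
  obtain ⟨O, hO, hOe⟩ := isOpen_induced_iff.1 e.open_target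
  have heg : ContinuousOn (fun p => e (g p)) S := e.continuousOn.comp g.continuous.continuousOn hg
  obtain ⟨ε, hε, hεO⟩ := (hS.image_of_continuousOn
      (hval.comp_continuousOn heg)).exists_thickening_subset_open hO (by
    rintro _ ⟨p, hp, rfl⟩
    have := e.map_source (hg hp)
    rwa [← hOe] at this)
  let move : K × HalfBall n ε → EuclideanHalfSpace n := fun z =>
    ⟨(e (g z.1)).1 + u z.1 • z.2.1, by
      simpa using add_nonneg (e (g z.1)).2 (mul_nonneg (hu z.1).1 z.2.2.1)⟩
  have hmove : ∀ z : K × HalfBall n ε, z.1 ∈ S → move z ∈ e.target := by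
    intro z hz
    rw [← hOe]
    refine hεO (Metric.mem_thickening_iff.2 ⟨_, ⟨z.1, hz, rfl⟩, ?_⟩)
    simp only [move, dist_eq_norm, Function.comp, add_sub_cancel_left, norm_smul,
      Real.norm_of_nonneg (hu z.1).1]
    exact (mul_le_of_le_one_left (norm_nonneg _) (hu z.1).2).trans_lt z.2.2.2
  have hmove0 : ∀ z : K × HalfBall n ε, u z.1 • z.2.1 = 0 → move z = e (g z.1) := fun z hz =>
    Subtype.ext (by simp [move, hz])
  have hmovec : ContinuousOn move (Prod.fst ⁻¹' S) := by
    refine Topology.IsInducing.subtypeVal.continuousOn_iff.2 ?_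
    have h1 : ContinuousOn (fun z : K × HalfBall n ε => (e (g z.1)).1) (Prod.fst ⁻¹' S) :=
      (hval.comp_continuousOn heg).comp continuousOn_fst fun _ hz => hz
    exact h1.add (by fun_prop)
  let Ξ : K × HalfBall n ε → X := fun z => if z.1 ∈ S then e.symm (move z) else g z.1
  have hΞ1 : ∀ z : K × HalfBall n ε, u z.1 • z.2.1 = 0 → Ξ z = g z.1 := by
    intro z hz
    by_cases hzS : z.1 ∈ S
    · simp only [Ξ, hzS, if_true]
      rw [hmove0 z hz, e.left_inv (hg hzS)]
    · simp [Ξ, hzS]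
  have hΞ : Continuous Ξ := by
    have h1 : ContinuousOn Ξ (Prod.fst ⁻¹' S) :=
      (e.continuousOn_symm.comp hmovec hmove).congr fun z hz => if_pos hz
    have h2 : ContinuousOn Ξ (Prod.fst ⁻¹' (interior S)ᶜ) :=
      ContinuousOn.congr (f := fun z => g z.1) (by fun_prop)
        fun z hz => hΞ1 z (by rw [hu0 z.1 hz, zero_smul])
    rw [← continuousOn_univ]
    refine (h1.union_of_isClosed h2 (hSc.preimage continuous_fst)
      (isOpen_interior.isClosed_compl.preimage continuous_fst)).mono fun z _ => ?_
    by_cases hz : z.1 ∈ S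
    · exact .inl hz
    · exact .inr fun h => hz (interior_subset h)
  refine ⟨ε, hε, ⟨Ξ, hΞ⟩, fun p v hv => hΞ1 (p, v) (by simp [hv]), fun p hp v => if_neg hp,
    fun p hp v => ?_⟩
  have : Ξ (p, v) = e.symm (move (p, v)) := if_pos hp
  simp only [coe_mk, this, e.right_inv (hmove (p, v) hp)]
  rfl

/-- Near `f`, every map can be deformed relative to `A` by arbitrarily small perturbations to a map
in `R`. -/
def PerturbsInto {K Y : Type*} [TopologicalSpace K] [TopologicalSpace Y] (A : Set K) (f : C(K, Y))
    (R : Set C(K, Y)) : Prop :=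
  ∀ᶠ g in 𝓝 f, ∃ᶠ g' in 𝓝 g, HomotopicRel g g' A ∧ g' ∈ R

namespace PerturbsInto

variable {K Y : Type*} [TopologicalSpace K] [TopologicalSpace Y] {A : Set K} {f : C(K, Y)}
  {R R' : Set C(K, Y)}

theorem of_eventually (h : ∀ᶠ g in 𝓝 f, g ∈ R) : PerturbsInto A f R :=
  h.mono fun g hg => Frequently.filter_mono (frequently_pure.2 ⟨.refl g, hg⟩) (pure_le_nhds g)

theorem inter (h : PerturbsInto A f R) (hR : IsOpen R) (h' : PerturbsInto A f R') :
    PerturbsInto A f (R ∩ R') := by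
  filter_upwards [h, eventually_eventually_nhds.2 h'] with g hg hg'
  refine frequently_frequently_nhds.1 ((hg.and_eventually hg').mono ?_)
  rintro g₁ ⟨⟨hgg₁, hg₁⟩, hg₁'⟩
  refine (hg₁'.and_eventually (hR.mem_nhds hg₁)).mono ?_
  rintro g₂ ⟨⟨hg₁g₂, hg₂'⟩, hg₂⟩
  exact ⟨hgg₁.trans hg₁g₂, hg₂, hg₂'⟩

theorem biInter {α : Type*} (s : Finset α) {R : α → Set C(K, Y)} (hR : ∀ a ∈ s, IsOpen (R a))
    (h : ∀ a ∈ s, PerturbsInto A f (R a)) : PerturbsInto A f (⋂ a ∈ s, R a) := by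
  classical
  induction s using Finset.induction_on with
  | empty => exact of_eventually (by simp)
  | insert a s _ ih =>
    rw [Finset.set_biInter_insert]
    exact (h a (by simp)).inter (hR a (by simp))
      (ih (fun b hb => hR b (by simp [hb])) fun b hb => h b (by simp [hb]))

theorem exists_homotopicRel (h : PerturbsInto A f R) : ∃ f', HomotopicRel f f' A ∧ f' ∈ R :=
  (h.self_of_nhds).exists

end PerturbsInto

/-- A family of perturbations of `g` parametrized by a half-ball and constant over `A` reaches `R`
as soon as arbitrarily small parameters do. -/
theorem frequently_of_perturbation {n : ℕ} [NeZero n] {K Y : Type*} [TopologicalSpace K]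
    [CompactSpace K] [T2Space K] [TopologicalSpace Y] {A : Set K} {g : C(K, Y)} {R : Set C(K, Y)}
    {ε : ℝ} (hε : 0 < ε) (Ψ : C(K × HalfBall n ε, Y)) (h0 : ∀ p v, v.1 = 0 → Ψ (p, v) = g p)
    (hA : ∀ p ∈ A, ∀ v, Ψ (p, v) = g p)
    (hR : ∀ δ > 0, ∃ ψ : C(K, HalfBall n ε),
      (∀ p, ‖(ψ p).1‖ < δ) ∧ Ψ.comp ((ContinuousMap.id K).prodMk ψ) ∈ R) :
    ∃ᶠ g' in 𝓝 g, HomotopicRel g g' A ∧ g' ∈ R := by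
  let T : C(K, HalfBall n ε) → C(K, Y) := fun ψ => Ψ.comp ((ContinuousMap.id K).prodMk ψ)
  have hT : Continuous T := by
    refine ContinuousMap.continuous_of_continuous_uncurry _ ?_
    change Continuous fun z : C(K, HalfBall n ε) × K => Ψ (z.2, z.1 z.2)
    fun_prop
  let z : C(K, HalfBall n ε) := .const K ⟨0, by simp, by simpa using hε⟩
  have hz : T z = g := ContinuousMap.ext fun p => h0 p _ rfl
  have hhom : ∀ ψ, HomotopicRel g (T ψ) A := fun ψ => ⟨
    { toFun := fun x => Ψ (x.2, HalfBall.scale x.1 (ψ x.2))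
      continuous_toFun := by
        refine Ψ.continuous.comp (continuous_snd.prodMk (Continuous.subtype_mk ?_ _))
        fun_prop
      map_zero_left := fun p => h0 p _ (by simp [HalfBall.scale])
      map_one_left := fun p => congrArg (fun v => Ψ (p, v)) (Subtype.ext (by simp [HalfBall.scale]))
      prop' := fun t p hp => hA p hp _ }⟩
  have hfreq : ∃ᶠ ψ in 𝓝 z, T ψ ∈ R := by
    refine Metric.nhds_basis_ball.frequently_iff.2 fun δ hδ => ?_
    obtain ⟨ψ, hψ, hψR⟩ := hR δ hδ
    refine ⟨ψ, ?_, hψR⟩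
    refine (ContinuousMap.dist_lt_iff hδ).2 fun p => ?_
    rw [Subtype.dist_eq, dist_eq_norm]
    simpa [z] using hψ p
  exact (hz ▸ hT.tendsto z).frequently (hfreq.mono fun ψ h => ⟨hhom ψ, h⟩)

section

variable {n : ℕ} [NeZero n] {K V X : Type*} [TopologicalSpace K] [CompactSpace K] [T2Space K]
  [NormedAddCommGroup V] [NormedSpace ℝ V] [FiniteDimensional ℝ V]
  [TopologicalSpace X] [T2Space X] [ChartedSpace (EuclideanHalfSpace n) X]

/-- Two distinct coordinates of a map to `X ^ k` can be made different near a given point. -/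
theorem exists_nhds_perturbsInto_ne (hV : Module.finrank ℝ V < n) {ι : K → V}
    (hι : Topology.IsEmbedding ι) {k : ℕ} {A : Set K} (hA : IsClosed A) (f : C(K, Fin k → X))
    (hf : ∀ p ∈ A, Function.Injective (f p)) {i j : Fin k} (hij : i ≠ j) (p : K) :
    ∃ C ∈ 𝓝 p, IsClosed C ∧ PerturbsInto A f {g | ∀ q ∈ C, g q i ≠ g q j} := by
  by_cases hp : f p i = f p j
  · have hpA : p ∉ A := fun h => hij (hf p h hp)
    let e := chartAt (EuclideanHalfSpace n) (f p i)
    let O : Set (Fin k → X) := {y | y i ∈ e.source ∧ y j ∈ e.source}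
    have hO : IsOpen O :=
      (e.open_source.preimage (continuous_apply i)).inter (e.open_source.preimage (continuous_apply j))
    have hfO : f p ∈ O := ⟨mem_chart_source _ _, hp ▸ mem_chart_source _ _⟩
    obtain ⟨S, ⟨hSp, hSc⟩, hS⟩ := (closed_nhds_basis p).mem_iff.1
      (inter_mem (f.continuous.continuousAt.preimage_mem_nhds (hO.mem_nhds hfO))
        (hA.isOpen_compl.mem_nhds hpA))
    obtain ⟨C, ⟨hCp, hCc⟩, hC⟩ := (closed_nhds_basis p).mem_iff.1 (interior_mem_nhds.2 hSp)
    obtain ⟨u, hu0, hu1, hu⟩ := exists_continuous_zero_one_of_isClosed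
      isOpen_interior.isClosed_compl hCc (disjoint_compl_left_iff_subset.2 hC)
    have hCS : C ⊆ S := hC.trans interior_subset
    refine ⟨C, hCp, hCc, ?_⟩
    filter_upwards [eventually_mapsTo hSc.isCompact hO fun q hq => (hS hq).1] with g hg
    let gi : C(K, X) := ⟨fun q => g q i, by fun_prop⟩
    obtain ⟨ε, hε, Ξ, hΞ0, hΞS, hΞ⟩ := exists_chart_perturbation e gi hSc.isCompact hSc
      (fun q hq => (hg hq).1) u hu hu0
    let Ψ : C(K × HalfBall n ε, Fin k → X) :=
      ⟨fun z => Function.update (g z.1) i (Ξ z), by fun_prop⟩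
    refine frequently_of_perturbation hε Ψ (fun q v hv => ?_) (fun q hq v => ?_) fun δ hδ => ?_
    · change Function.update (g q) i (Ξ (q, v)) = g q
      rw [hΞ0 q v hv]
      exact Function.update_eq_self i (g q)
    · change Function.update (g q) i (Ξ (q, v)) = g q
      rw [hΞS q (fun h => (hS h).2 hq) v]
      exact Function.update_eq_self i (g q)
    · have hval : Continuous (Subtype.val : EuclideanHalfSpace n → EuclideanSpace ℝ (Fin n)) :=
        continuous_subtype_val
      have hcont : ∀ l : Fin k, (∀ q ∈ C, g q l ∈ e.source) →
          ContinuousOn (fun q => (e (g q l)).1) C := fun l hl =>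
        hval.comp_continuousOn (e.continuousOn.comp (by fun_prop) hl)
      obtain ⟨ψ, hψ, hψne⟩ := exists_small_forall_ne hV hι hCc.isCompact
        ((hcont j fun q hq => (hg (hCS hq)).2).sub (hcont i fun q hq => (hg (hCS hq)).1))
        (lt_min hδ hε)
      refine ⟨⟨fun q => ⟨ψ q, (hψ q).1, (hψ q).2.trans_le (min_le_right _ _)⟩, by fun_prop⟩,
        fun q => (hψ q).2.trans_le (min_le_left _ _), fun q hq heq => hψne q hq ?_⟩
      have h1 : Ξ (q, ⟨ψ q, (hψ q).1, (hψ q).2.trans_le (min_le_right _ _)⟩) = g q j := by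
        simpa [Ψ, hij.symm] using heq
      have h2 := hΞ q (hCS hq) ⟨ψ q, (hψ q).1, (hψ q).2.trans_le (min_le_right _ _)⟩
      rw [h1, hu1 hq] at h2
      simp only [Pi.one_apply, one_smul] at h2
      exact eq_sub_of_add_eq' h2.symm
  · have hO : IsOpen {y : Fin k → X | y i ≠ y j} :=
      isOpen_ne_fun (continuous_apply i) (continuous_apply j)
    obtain ⟨C, ⟨hCp, hCc⟩, hC⟩ := (closed_nhds_basis p).mem_iff.1
      (f.continuous.continuousAt.preimage_mem_nhds (hO.mem_nhds hp))
    exact ⟨C, hCp, hCc, .of_eventually (eventually_mapsTo hCc.isCompact hO hC)⟩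

/-- **General position** for configurations: a map from a compact space embedded in dimension less
than `n` to the `k`-th power of an `n`-manifold with boundary can be deformed, relative to a closed
set already mapped to the configuration space, to a map to the configuration space. -/
theorem exists_homotopicRel_forall_injective (hV : Module.finrank ℝ V < n) {ι : K → V}
    (hι : Topology.IsEmbedding ι) {k : ℕ} {A : Set K} (hA : IsClosed A) (f : C(K, Fin k → X))
    (hf : ∀ p ∈ A, Function.Injective (f p)) :
    ∃ f', HomotopicRel f f' A ∧ ∀ p, Function.Injective (f' p) := by
  have hopen : ∀ (i j : Fin k) {C : Set K}, IsClosed C →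
      IsOpen {g : C(K, Fin k → X) | ∀ q ∈ C, g q i ≠ g q j} := fun i j C hC =>
    isOpen_setOfPred_mapsTo hC.isCompact
      (isOpen_ne_fun (continuous_apply i) (continuous_apply j) : IsOpen {y : Fin k → X | y i ≠ y j})
  have hpair : ∀ i j : Fin k, i ≠ j →
      PerturbsInto A f {g | ∀ q ∈ (univ : Set K), g q i ≠ g q j} := by
    intro i j hij
    obtain ⟨C, hC, -, hCf⟩ := isCompact_univ.induction_on
      (p := fun S : Set K => ∃ C, S ⊆ C ∧ IsClosed C ∧
        PerturbsInto A f {g | ∀ q ∈ C, g q i ≠ g q j})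
      ⟨∅, Subset.rfl, isClosed_empty, .of_eventually (by simp)⟩
      (fun S T hST ⟨C, hC, h⟩ => ⟨C, hST.trans hC, h⟩)
      (fun S T ⟨C, hSC, hC, h⟩ ⟨D, hTD, hD, h'⟩ =>
        ⟨C ∪ D, union_subset_union hSC hTD, hC.union hD, by
          convert h.inter (hopen i j hC) h' using 1
          ext g
          simp [or_imp, forall_and]⟩)
      (fun p _ => by
        obtain ⟨C, hCp, hC, h⟩ := exists_nhds_perturbsInto_ne hV hι hA f hf hij p
        exact ⟨C, mem_nhdsWithin_of_mem_nhds hCp, C, Subset.rfl, hC, h⟩)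
    rwa [univ_subset_iff.1 hC] at hCf
  obtain ⟨f', hff', hf'⟩ := (PerturbsInto.biInter (A := A) (f := f)
    (Finset.univ.filter fun z : Fin k × Fin k => z.1 ≠ z.2)
    (fun z _ => hopen z.1 z.2 isClosed_univ)
    fun z hz => hpair z.1 z.2 (Finset.mem_filter.1 hz).2).exists_homotopicRel
  refine ⟨f', hff', fun p i j h => by_contra fun hij => ?_⟩
  simp only [mem_iInter] at hf'
  exact hf' (i, j) (by simpa using hij) p (mem_univ p) h

theorem isClosed_cube_boundary (N : Type*) [Finite N] : IsClosed (Cube.boundary N) := by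
  have : Cube.boundary N = ⋃ i, {y | y i = 0 ∨ y i = 1} := by
    ext y
    simp [Cube.boundary]
  rw [this]
  exact isClosed_iUnion_of_finite fun i =>
    (isClosed_eq (continuous_apply i) continuous_const).union
      (isClosed_eq (continuous_apply i) continuous_const)

theorem isEmbedding_cube (N : Type*) :
    Topology.IsEmbedding (fun (y : N → I) (i : N) => (y i : ℝ)) :=
  .piMap fun _ => .subtypeVal

theorem surjective_homotopyGroup_induced_confToPi {q k : ℕ} (hq : q < n) (x : Conf X k) :
    Function.Surjective (HomotopyGroup.induced (N := Fin q) (confToPi X k) x) := by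
  rintro ⟨β⟩
  obtain ⟨f', hf', hinj⟩ := exists_homotopicRel_forall_injective (n := n) (by simpa using hq)
    (isEmbedding_cube (Fin q)) (isClosed_cube_boundary _) β.1
    fun p hp => by rw [β.2 p hp]; exact x.2
  refine ⟨⟦⟨⟨fun p => ⟨f' p, hinj p⟩, by fun_prop⟩, fun p hp => Subtype.ext ?_⟩⟧,
    Quotient.sound ?_⟩
  · exact (hf'.fst_eq_snd hp).symm.trans (β.2 p hp)
  · exact hf'.symm

theorem injective_homotopyGroup_induced_confToPi {q k : ℕ} (hq : q + 1 < n) (x : Conf X k) :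
    Function.Injective (HomotopyGroup.induced (N := Fin q) (confToPi X k) x) := by
  rintro ⟨α⟩ ⟨β⟩ h
  obtain ⟨H⟩ : HomotopicRel _ _ _ := Quotient.exact h
  let A : Set (I × (Fin q → I)) := {z | (z.1 = 0 ∨ z.1 = 1) ∨ z.2 ∈ Cube.boundary (Fin q)}
  have hA : IsClosed A :=
    ((isClosed_eq continuous_fst continuous_const).union
      (isClosed_eq continuous_fst continuous_const)).union
      ((isClosed_cube_boundary _).preimage continuous_snd)
  obtain ⟨H', hH', hinj⟩ := exists_homotopicRel_forall_injective (n := n)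
    (V := ℝ × (Fin q → ℝ)) (by simpa [add_comm] using hq)
    (Topology.IsEmbedding.subtypeVal.prodMap (isEmbedding_cube (Fin q))) hA H.toContinuousMap (by
      rintro ⟨t, y⟩ ((rfl | rfl) | hy)
      · rw [show H.toContinuousMap (0, y) = _ from H.apply_zero y]
        exact (α.1 y).2
      · rw [show H.toContinuousMap (1, y) = _ from H.apply_one y]
        exact (β.1 y).2
      · rw [show H.toContinuousMap (t, y) = _ from H.eq_fst t hy]
        exact (α.1 y).2)
  refine Quotient.sound ⟨
    { toFun := fun z => ⟨H' z, hinj z⟩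
      continuous_toFun := by fun_prop
      map_zero_left := fun y => Subtype.ext ?_
      map_one_left := fun y => Subtype.ext ?_
      prop' := fun t y hy => Subtype.ext ?_ }⟩
  · exact (hH'.fst_eq_snd (.inl (.inl rfl))).symm.trans (H.apply_zero y)
  · exact (hH'.fst_eq_snd (.inl (.inr rfl))).symm.trans (H.apply_one y)
  · exact (hH'.fst_eq_snd (x := (t, y)) (.inr hy)).symm.trans (H.eq_fst t hy)

end

end GeneralPosition

/-- The inclusion `i_k(M − Q) : F(M − Q, k) → (M − Q)^k` is
`(dim M − 1)`-connected. -/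
theorem stmt9 (n : ℕ) [NeZero n] (M : Type) [TopologicalSpace M] [T2Space M]
    [SecondCountableTopology M] [CompactSpace M] [ConnectedSpace M]
    [ChartedSpace (EuclideanHalfSpace n) M]
    (hbd : ((mfdInterior n M)ᶜ : Set M).Nonempty)
    (m : ℕ) (Q : Finset M) (hQcard : Q.card = m)
    (hQ : (↑Q : Set M) ⊆ mfdInterior n M)
    (k : ℕ) (hk : 1 ≤ k) :
    ∀ x : Conf (↥((↑Q : Set M)ᶜ)) k,
      Function.Surjective
        (HomotopyGroup.induced (N := Fin (n - 1)) (confToPi (↥((↑Q : Set M)ᶜ)) k) x) ∧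
      ∀ q : ℕ, q + 2 ≤ n →
        Function.Bijective
          (HomotopyGroup.induced (N := Fin q) (confToPi (↥((↑Q : Set M)ᶜ)) k) x) := by
  let U : TopologicalSpace.Opens M := ⟨(↑Q : Set M)ᶜ, Q.finite_toSet.isClosed.isOpen_compl⟩
  let _ : ChartedSpace (EuclideanHalfSpace n) (↥((↑Q : Set M)ᶜ)) :=
    inferInstanceAs (ChartedSpace (EuclideanHalfSpace n) U)
  have hn : 0 < n := NeZero.pos n
  exact fun x => ⟨surjective_homotopyGroup_induced_confToPi (n := n) (by omega) x, fun q hq =>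
    ⟨injective_homotopyGroup_induced_confToPi (n := n) (by omega) x,
      surjective_homotopyGroup_induced_confToPi (n := n) (by omega) x⟩⟩
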